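/- arXiv:1510.03670 — 3 statements merged into one kernel-verified Lean document; each statement's English description precedes it below -/
import Mathlib

section
/- For every monomial order ≺' on F[x,y], the initial ideal In_{≺'}(I_E) of the vanishing ideal I_E of E is equal either to ⟨y^{q}, x^{q^2}⟩ or to ⟨x^{q+1}, x·y^{q^2-q}, y^{q^2}⟩. -/
open MvPolynomial

noncomputable section

/-- The monomial `x^r y^s` in `F[x,y]`, where `x = X 0`, `y = X 1`. -/
def monoXY (F : Type) [Field F] (r s : ℕ) : MvPolynomial (Fin 2) F := X 0 ^ r * X 1 ^ s

/-- The Hermitian polynomial `H = x^(q+1) - y^q - y`. -/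
def Hpoly (F : Type) [Field F] (q : ℕ) : MvPolynomial (Fin 2) F :=
  X 0 ^ (q + 1) - X 1 ^ q - X 1

/-- Evaluation of a bivariate polynomial at a point of `F × F`. -/
def evalPt {F : Type} [Field F] (p : F × F) (f : MvPolynomial (Fin 2) F) : F :=
  MvPolynomial.eval ![p.1, p.2] f

/-- The vanishing ideal of a set of points `S ⊆ F × F`. -/
def vanIdeal (F : Type) [Field F] (S : Set (F × F)) : Ideal (MvPolynomial (Fin 2) F) where
  carrier := {f | ∀ p ∈ S, evalPt p f = 0}
  add_mem' := by
    intro a b ha hb p hp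
    have h1 := ha p hp
    have h2 := hb p hp
    simp only [evalPt] at h1 h2 ⊢
    simp [map_add, h1, h2]
  zero_mem' := by
    intro p hp
    simp [evalPt]
  smul_mem' := by
    intro c f hf p hp
    have h1 := hf p hp
    simp only [evalPt] at h1 ⊢
    simp [smul_eq_mul, map_mul, h1]

/-- The `DegRevLex` order with `y > x`, on exponent pairs `(a, b) ↔ x^a y^b`. -/
def precOrd : ℕ × ℕ → ℕ × ℕ → Prop := fun a b =>
  a.1 + a.2 < b.1 + b.2 ∨ (a.1 + a.2 = b.1 + b.2 ∧ a.2 < b.2)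

/-- The pair of exponents `(d 0, d 1)` of an exponent finsupp. -/
def expPair (d : Fin 2 →₀ ℕ) : ℕ × ℕ := (d 0, d 1)

/-- `x^r y^s` is the leading monomial of `f` with respect to the monomial order `lt`. -/
def IsLMwith {F : Type} [Field F] (lt : ℕ × ℕ → ℕ × ℕ → Prop)
    (f : MvPolynomial (Fin 2) F) (r s : ℕ) : Prop :=
  MvPolynomial.coeff (Finsupp.single 0 r + Finsupp.single 1 s) f ≠ 0 ∧
    ∀ d ∈ f.support, expPair d = (r, s) ∨ lt (expPair d) (r, s)

/-- The initial ideal of `I` w.r.t. the monomial order `lt`: the ideal generated by the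
leading monomials of the nonzero elements of `I`. -/
def initialIdealWith {F : Type} [Field F] (lt : ℕ × ℕ → ℕ × ℕ → Prop)
    (I : Ideal (MvPolynomial (Fin 2) F)) : Ideal (MvPolynomial (Fin 2) F) :=
  Ideal.span {g | ∃ f ∈ I, f ≠ 0 ∧ ∃ r s, IsLMwith lt f r s ∧ g = monoXY F r s}

/-- The set `E` of `F`-rational affine points of the Hermitian curve. -/
def Eset (F : Type) [Field F] (q : ℕ) : Set (F × F) :=
  {p | p.1 ^ (q + 1) = p.2 ^ q + p.2}

/-- The set `B` of (exponent pairs of) monomials. -/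
def Bset (q : ℕ) : Set (ℕ × ℕ) :=
  {p | (p.1 ≤ q ∧ p.2 ≤ q ^ 2 - q - 1) ∨ (p.1 = 0 ∧ q ^ 2 - q ≤ p.2 ∧ p.2 ≤ q ^ 2 - 1)}

/-- The Hermitian code `C_m` (as a set of vectors), for the enumeration `P` of `E`. -/
def codeSet (F : Type) [Field F] (q m : ℕ) (P : Fin (q ^ 3) → F × F) :
    Set (Fin (q ^ 3) → F) :=
  {c | ∀ r s : ℕ, r * q + s * (q + 1) ≤ m → ∑ i, c i * ((P i).1 ^ r * (P i).2 ^ s) = 0}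

/-- The weight of a codeword: the number of nonzero entries. -/
def wt {F : Type} [Field F] {n : ℕ} (c : Fin n → F) : ℕ := {i | c i ≠ 0}.ncard

/-- The support of a codeword, as a set of points of the curve. -/
def suppPts {F : Type} [Field F] {n : ℕ} (P : Fin n → F × F) (c : Fin n → F) :
    Set (F × F) :=
  P '' {i | c i ≠ 0}

end

section InitialIdeal

variable {F : Type} [Field F]

theorem monoXY_eq_monomial (r s : ℕ) :
    monoXY F r s = monomial (Finsupp.single 0 r + Finsupp.single 1 s) 1 := by
  rw [monoXY, X_pow_eq_monomial, X_pow_eq_monomial, monomial_mul, one_mul]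

theorem monoXY_mul (r s r' s' : ℕ) :
    monoXY F r s * monoXY F r' s' = monoXY F (r + r') (s + s') := by
  simp only [monoXY, pow_add]
  ring

theorem evalPt_eq_sum (p : F × F) (f : MvPolynomial (Fin 2) F) :
    evalPt p f = ∑ d ∈ f.support, f.coeff d * (p.1 ^ d 0 * p.2 ^ d 1) := by
  simp [evalPt, eval_eq']

theorem expPair_single_add_single (r s : ℕ) :
    expPair (Finsupp.single 0 r + Finsupp.single 1 s) = (r, s) := by
  simp [expPair]

theorem eq_single_add_single_of_expPair_eq {d : Fin 2 →₀ ℕ} {r s : ℕ} (h : expPair d = (r, s)) :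
    d = Finsupp.single 0 r + Finsupp.single 1 s := by
  simp only [expPair, Prod.mk.injEq] at h
  ext i
  fin_cases i <;> simp [h.1, h.2]

theorem monoXY_mem_restrictSupport {lt : ℕ × ℕ → ℕ × ℕ → Prop} {m : ℕ × ℕ} {r s : ℕ}
    (h : lt (r, s) m) : monoXY F r s ∈ restrictSupport F {d | lt (expPair d) m} := by
  rw [monoXY_eq_monomial, mem_restrictSupport_iff]
  intro d hd
  have := support_monomial_subset hd
  rw [Finset.mem_singleton] at this
  subst this
  simpa [expPair_single_add_single] using h

theorem isLMwith_monoXY_add {lt : ℕ × ℕ → ℕ × ℕ → Prop} (hirr : ∀ a, ¬ lt a a) {r s : ℕ}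
    {h : MvPolynomial (Fin 2) F} (hh : h ∈ restrictSupport F {d | lt (expPair d) (r, s)}) :
    IsLMwith lt (monoXY F r s + h) r s := by
  rw [mem_restrictSupport_iff] at hh
  constructor
  · have h0 : coeff (Finsupp.single 0 r + Finsupp.single 1 s) h = 0 := by
      by_contra hne
      have := hh (mem_support_iff.2 hne)
      rw [Set.mem_ofPred_eq, expPair_single_add_single] at this
      exact hirr _ this
    rw [coeff_add, h0, monoXY_eq_monomial, coeff_monomial]
    simp
  · intro d hd
    rcases Finset.mem_union.1 (support_add hd) with hd | hd
    · rw [monoXY_eq_monomial] at hd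
      have := Finset.mem_singleton.1 (support_monomial_subset hd)
      exact Or.inl (this ▸ expPair_single_add_single r s)
    · exact Or.inr (hh hd)

/-- The vector of values of the monomial `x^r y^s` on `S`, where `m = (r, s)`. -/
def monoValues (S : Set (F × F)) (m : ℕ × ℕ) : S → F := fun p => p.1.1 ^ m.1 * p.1.2 ^ m.2

/-- The evaluation of a polynomial with leading monomial `g` vanishing on `S` expresses the values
of any multiple of the monomial `g` through those of smaller monomials. -/
theorem monoValues_mem_span_lt {lt : ℕ × ℕ → ℕ × ℕ → Prop}
    (hmul : ∀ a b t, lt a b → lt (a + t) (b + t)) {S : Set (F × F)}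
    {f : MvPolynomial (Fin 2) F} (hf : f ∈ vanIdeal F S) {g : ℕ × ℕ} (hg : IsLMwith lt f g.1 g.2)
    (t : ℕ × ℕ) :
    monoValues S (g + t) ∈ Submodule.span F (monoValues S '' {m | lt m (g + t)}) := by
  set e : Fin 2 →₀ ℕ := Finsupp.single 0 g.1 + Finsupp.single 1 g.2 with he
  have he' : expPair e = g := expPair_single_add_single _ _
  have hrel : ∑ d ∈ f.support, f.coeff d • monoValues S (expPair d + t) = 0 := by
    funext p
    have h := evalPt_eq_sum p.1 f
    rw [hf p.1 p.2] at h
    have h2 := congrArg (· * (p.1.1 ^ t.1 * p.1.2 ^ t.2)) h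
    simp only [zero_mul, Finset.sum_mul] at h2
    rw [Finset.sum_apply, Pi.zero_apply, h2]
    refine Finset.sum_congr rfl fun d _ => ?_
    simp only [Pi.smul_apply, smul_eq_mul, monoValues, expPair, Prod.fst_add, Prod.snd_add,
      pow_add]
    ring
  rw [← Finset.add_sum_erase _ _ (mem_support_iff.2 hg.1), ← he, he'] at hrel
  have hmem : f.coeff e • monoValues S (g + t) ∈
      Submodule.span F (monoValues S '' {m | lt m (g + t)}) := by
    rw [eq_neg_of_add_eq_zero_left hrel]
    refine neg_mem (Submodule.sum_mem _ fun d hd => Submodule.smul_mem _ _ ?_)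
    obtain ⟨hne, hd⟩ := Finset.mem_erase.1 hd
    refine Submodule.subset_span ⟨_, hmul _ _ _ ?_, rfl⟩
    refine (hg.2 d hd).resolve_left fun h => hne ?_
    rw [eq_single_add_single_of_expPair_eq h]
  exact (Submodule.smul_mem_iff _ hg.1).1 hmem

theorem span_range_monoValues [Finite F] (S : Set (F × F)) :
    Submodule.span F (Set.range (monoValues S)) = ⊤ := by
  classical
  have := Fintype.ofFinite F
  refine eq_top_iff.2 fun u _ => ?_
  obtain ⟨f, -, hf⟩ := (map_restrict_dom_evalₗ F (Fin 2)).ge (Submodule.mem_top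
    (x := fun w : Fin 2 → F => if h : (w 0, w 1) ∈ S then u ⟨_, h⟩ else 0))
  have : u = ∑ d ∈ f.support, f.coeff d • monoValues S (expPair d) := by
    funext p
    have h := congrFun hf ![p.1.1, p.1.2]
    have h2 := evalPt_eq_sum p.1 f
    simp only [evalPt] at h2
    rw [evalₗ_apply, h2] at h
    simpa [monoValues, expPair] using h.symm
  rw [this]
  exact Submodule.sum_mem _ fun d _ => Submodule.smul_mem _ _ (Submodule.subset_span ⟨_, rfl⟩)

/-- If the leading monomials `G` of elements of the vanishing ideal of `S` divide all but at most
`|S|` monomials, then they generate the initial ideal. -/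
theorem initialIdealWith_vanIdeal_eq_span [Finite F] {lt : ℕ × ℕ → ℕ × ℕ → Prop}
    (hirr : ∀ a, ¬ lt a a) (htrans : ∀ a b c, lt a b → lt b c → lt a c) (hwf : WellFounded lt)
    (hmul : ∀ a b t, lt a b → lt (a + t) (b + t)) (S : Set (F × F)) (G : Set (ℕ × ℕ))
    (hG : ∀ g ∈ G, ∃ f ∈ vanIdeal F S, IsLMwith lt f g.1 g.2)
    (B : Finset (ℕ × ℕ)) (hB : ∀ m, m ∉ B → ∃ g ∈ G, g ≤ m) (hcard : B.card ≤ Nat.card S) :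
    initialIdealWith lt (vanIdeal F S) =
      Ideal.span ((fun g => monoXY F g.1 g.2) '' G) := by
  classical
  have := Fintype.ofFinite F
  let V : ℕ × ℕ → Set (S → F) := fun m => monoValues S '' {b | b ∈ B ∧ (b = m ∨ lt b m)}
  have hV : ∀ m, monoValues S m ∈ Submodule.span F (V m) := by
    intro m
    induction m using hwf.induction with
    | _ m ih =>
      by_cases hm : m ∈ B
      · exact Submodule.subset_span ⟨m, ⟨hm, Or.inl rfl⟩, rfl⟩
      · obtain ⟨g, hg, hgm⟩ := hB m hm
        obtain ⟨t, rfl⟩ := exists_add_of_le hgm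
        obtain ⟨f, hf, hlm⟩ := hG g hg
        refine Submodule.span_le.2 ?_ (monoValues_mem_span_lt hmul hf hlm t)
        rintro _ ⟨m', hm', rfl⟩
        refine Submodule.span_mono (Set.image_mono ?_) (ih m' hm')
        rintro b ⟨hb, rfl | hlt⟩
        · exact ⟨hb, Or.inr hm'⟩
        · exact ⟨hb, Or.inr (htrans _ _ _ hlt hm')⟩
  have hspan : ⊤ ≤ Submodule.span F (Set.range fun b : B => monoValues S b) := by
    rw [← span_range_monoValues S, Submodule.span_le]
    rintro _ ⟨m, rfl⟩
    refine Submodule.span_mono ?_ (hV m)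
    rintro _ ⟨b, ⟨hb, -⟩, rfl⟩
    exact ⟨⟨b, hb⟩, rfl⟩
  have hli : LinearIndependent F fun b : B => monoValues S b := by
    refine linearIndependent_of_top_le_span_of_card_le_finrank hspan ?_
    rw [Module.finrank_pi, Fintype.card_coe, ← Nat.card_eq_fintype_card]
    exact hcard
  refine le_antisymm (Ideal.span_le.2 ?_) (Ideal.span_le.2 ?_)
  · rintro _ ⟨f, hf, -, r, s, hlm, rfl⟩
    have hm : (r, s) ∉ B := by
      intro hm
      refine hli.notMem_span_image (s := {b | lt b (r, s)}) (x := ⟨_, hm⟩) (hirr _) ?_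
      have h := monoValues_mem_span_lt hmul hf (g := (r, s)) hlm 0
      rw [add_zero] at h
      refine Submodule.span_le.2 ?_ h
      rintro _ ⟨m', hm', rfl⟩
      refine Submodule.span_mono ?_ (hV m')
      rintro _ ⟨b, ⟨hb, hb'⟩, rfl⟩
      refine ⟨⟨b, hb⟩, ?_, rfl⟩
      rcases hb' with rfl | hlt
      · exact hm'
      · exact htrans _ _ _ hlt hm'
    obtain ⟨g, hg, hgm⟩ := hB _ hm
    obtain ⟨t, ht⟩ := exists_add_of_le hgm
    have h1 : r = g.1 + t.1 := congrArg Prod.fst ht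
    have h2 : s = g.2 + t.2 := congrArg Prod.snd ht
    rw [h1, h2, ← monoXY_mul]
    exact Ideal.mul_mem_right _ _ (Ideal.subset_span ⟨g, hg, rfl⟩)
  · rintro _ ⟨g, hg, rfl⟩
    obtain ⟨f, hf, hlm⟩ := hG g hg
    refine Ideal.subset_span ⟨f, hf, ?_, _, _, hlm, rfl⟩
    rintro rfl
    exact hlm.1 (coeff_zero _)

end InitialIdeal

section Hermitian

variable {F : Type} [Field F]

theorem Hpoly_mem_vanIdeal (q : ℕ) : Hpoly F q ∈ vanIdeal F (Eset F q) := by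
  intro p hp
  have hp : p.1 ^ (q + 1) = p.2 ^ q + p.2 := hp
  simp [evalPt, Hpoly, hp]

theorem X_pow_mul_aeval_eq_monoXY_add {P : Polynomial F} (hP : P.Monic) (a : ℕ) :
    (X 0 ^ a * Polynomial.aeval (X 1) P : MvPolynomial (Fin 2) F) =
      monoXY F a P.natDegree + ∑ i ∈ Finset.range P.natDegree, P.coeff i • monoXY F a i := by
  rw [Polynomial.aeval_eq_sum_range, Finset.sum_range_succ, hP.coeff_natDegree, one_smul, mul_add,
    Finset.mul_sum, add_comm]
  simp [monoXY]

theorem monic_pow_add_X_pow_sub_one {q : ℕ} (hq2 : 2 ≤ q) :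
    ((Polynomial.X ^ q + Polynomial.X) ^ (q - 1) - 1 : Polynomial F).Monic ∧
      ((Polynomial.X ^ q + Polynomial.X) ^ (q - 1) - 1 : Polynomial F).natDegree = q ^ 2 - q := by
  have hlt : (Polynomial.X : Polynomial F).natDegree
      < (Polynomial.X ^ q : Polynomial F).natDegree := by
    rw [Polynomial.natDegree_X, Polynomial.natDegree_X_pow]
    omega
  have hmonic : (Polynomial.X ^ q + Polynomial.X : Polynomial F).Monic :=
    (Polynomial.monic_X_pow q).add_of_left (Polynomial.degree_lt_degree hlt)
  have hdeg : ((Polynomial.X ^ q + Polynomial.X : Polynomial F) ^ (q - 1)).natDegree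
      = q ^ 2 - q := by
    rw [hmonic.natDegree_pow, Polynomial.natDegree_add_eq_left_of_natDegree_lt hlt,
      Polynomial.natDegree_X_pow, Nat.sub_mul, one_mul, sq]
  have hone : (1 : Polynomial F).natDegree
      < ((Polynomial.X ^ q + Polynomial.X : Polynomial F) ^ (q - 1)).natDegree := by
    rw [hdeg, Polynomial.natDegree_one]
    have : q < q ^ 2 := by nlinarith
    omega
  exact ⟨(hmonic.pow _).sub_of_left (Polynomial.degree_lt_degree hone),
    (Polynomial.natDegree_sub_eq_left_of_natDegree_lt hone).trans hdeg⟩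

variable [Fintype F]

theorem X_mul_pow_add_X_pow_sub_one_mem_vanIdeal {q : ℕ} (hq2 : 2 ≤ q)
    (hF : Fintype.card F = q ^ 2) :
    (X 0 ^ 1 * Polynomial.aeval (X 1)
      ((Polynomial.X ^ q + Polynomial.X) ^ (q - 1) - 1 : Polynomial F) :
        MvPolynomial (Fin 2) F) ∈ vanIdeal F (Eset F q) := by
  intro p hp
  have hp : p.1 ^ (q + 1) = p.2 ^ q + p.2 := hp
  have hx : p.1 * (p.1 ^ (q + 1)) ^ (q - 1) = p.1 := by
    rw [← pow_mul, ← pow_succ']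
    obtain ⟨k, rfl⟩ := Nat.exists_eq_add_of_le' hq2
    convert FiniteField.pow_card p.1 using 2
    rw [hF, Nat.add_succ_sub_one]
    ring
  simp [evalPt, ← hp, mul_sub, hx]

theorem exists_expChar_pow_eq {q : ℕ} (hq : IsPrimePow q) (hF : Fintype.card F = q ^ 2) :
    ∃ p k : ℕ, ExpChar F p ∧ q = p ^ k := by
  obtain ⟨p, k, hp, -, rfl⟩ := (isPrimePow_nat_iff q).1 hq
  obtain ⟨p', hchar, n, hp', hn⟩ := FiniteField.card' F
  have hdvd : p' ∣ (p ^ k) ^ 2 := by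
    rw [← hF, hn]
    exact dvd_pow_self _ n.pos.ne'
  have : p' = p :=
    (Nat.prime_dvd_prime_iff_eq hp' hp).1 (hp'.dvd_of_dvd_pow (hp'.dvd_of_dvd_pow hdvd))
  subst this
  exact ⟨p', k, ExpChar.prime hp', rfl⟩

open Polynomial in
theorem le_card_pow_add_self_eq {q : ℕ} (hq2 : 2 ≤ q) (hq : IsPrimePow q)
    (hF : Fintype.card F = q ^ 2) {z : F} (hz : z ^ q = z) :
    q ≤ Nat.card {y : F // z = y ^ q + y} := by
  classical
  obtain ⟨p, k, hp, hqp⟩ := exists_expChar_pow_eq hq hF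
  set P : F[X] := Polynomial.X ^ q + (Polynomial.X - Polynomial.C z) with hP
  have hdeg : P.natDegree = q := by
    rw [hP, natDegree_add_eq_left_of_natDegree_lt, natDegree_X_pow]
    rw [natDegree_X_pow, natDegree_X_sub_C]
    omega
  have hdvd : P ∣ Polynomial.X ^ Fintype.card F - Polynomial.X := by
    have hpow : P ^ q - P = Polynomial.X ^ Fintype.card F - Polynomial.X := by
      have h : P ^ q = (Polynomial.X ^ q) ^ q + (Polynomial.X ^ q - Polynomial.C z ^ q) := by
        rw [hP]
        subst hqp
        rw [add_pow_expChar_pow, sub_pow_expChar_pow]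
      rw [h, ← Polynomial.C_pow, hz, hF, sq, pow_mul, hP]
      ring
    rw [← hpow]
    exact dvd_sub (dvd_pow_self _ (by omega)) dvd_rfl
  have hne : (Polynomial.X ^ Fintype.card F - Polynomial.X : F[X]) ≠ 0 :=
    FiniteField.X_pow_card_sub_X_ne_zero F Fintype.one_lt_card
  have hroots := FiniteField.roots_X_pow_card_sub_X F
  have hsplits : (Polynomial.X ^ Fintype.card F - Polynomial.X : F[X]).Splits := by
    rw [splits_iff_card_roots, hroots, ← Finset.card_def, Finset.card_univ,
      FiniteField.X_pow_card_sub_X_natDegree_eq F Fintype.one_lt_card]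
  have hnodup : P.roots.Nodup :=
    Multiset.nodup_of_le (roots.le_of_dvd hne hdvd) (hroots ▸ Finset.univ.nodup)
  have hP0 : P ≠ 0 := ne_zero_of_dvd_ne_zero hne hdvd
  calc q = P.roots.toFinset.card := by
        rw [Multiset.toFinset_card_of_nodup hnodup,
          ← (hsplits.of_dvd hne hdvd).natDegree_eq_card_roots, hdeg]
    _ ≤ (Finset.univ.filter fun y : F => z = y ^ q + y).card := by
        refine Finset.card_le_card fun y hy => ?_
        rw [Multiset.mem_toFinset, mem_roots hP0, IsRoot, hP] at hy
        simp only [Polynomial.eval_add, Polynomial.eval_sub, Polynomial.eval_pow,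
          Polynomial.eval_X, Polynomial.eval_C] at hy
        rw [Finset.mem_filter]
        exact ⟨Finset.mem_univ _, by linear_combination -hy⟩
    _ = Nat.card {y : F // z = y ^ q + y} := by
        rw [Nat.card_eq_fintype_card, Fintype.card_subtype]

theorem pow_three_le_card_Eset {q : ℕ} (hq2 : 2 ≤ q) (hq : IsPrimePow q)
    (hF : Fintype.card F = q ^ 2) : q ^ 3 ≤ Nat.card (Eset F q) := by
  classical
  let e : (Σ x : F, {y : F // x ^ (q + 1) = y ^ q + y}) ≃ Eset F q :=
    { toFun := fun w => ⟨(w.1, w.2.1), w.2.2⟩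
      invFun := fun w => ⟨w.1.1, w.1.2, w.2⟩
      left_inv := fun _ => rfl
      right_inv := fun _ => rfl }
  rw [← Nat.card_congr e, Nat.card_sigma]
  calc q ^ 3 = ∑ _x : F, q := by
        rw [Finset.sum_const, Finset.card_univ, hF, smul_eq_mul]
        ring
    _ ≤ _ := Finset.sum_le_sum fun x _ => le_card_pow_add_self_eq hq2 hq hF ?_
  have hx : x ^ (q ^ 2) = x := hF ▸ FiniteField.pow_card x
  calc (x ^ (q + 1)) ^ q = x ^ (q ^ 2) * x ^ q := by ring
    _ = x ^ (q + 1) := by rw [hx]; ring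

end Hermitian

theorem stmt_3 (q : ℕ) (hq2 : 2 ≤ q) (hq : IsPrimePow q)
    (F : Type) [Field F] [Fintype F] (hF : Fintype.card F = q ^ 2)
    (lt : ℕ × ℕ → ℕ × ℕ → Prop)
    (hirr : ∀ a, ¬ lt a a)
    (htrans : ∀ a b c, lt a b → lt b c → lt a c)
    (htot : ∀ a b, a = b ∨ lt a b ∨ lt b a)
    (hwf : WellFounded lt)
    (hone : ∀ a, a = (0, 0) ∨ lt (0, 0) a)
    (hmul : ∀ a b t, lt a b → lt (a + t) (b + t)) :
    initialIdealWith lt (vanIdeal F (Eset F q)) =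
        Ideal.span {monoXY F 0 q, monoXY F (q ^ 2) 0} ∨
      initialIdealWith lt (vanIdeal F (Eset F q)) =
        Ideal.span {monoXY F (q + 1) 0, monoXY F 1 (q ^ 2 - q), monoXY F 0 (q ^ 2)} := by
  have hxF : ∀ x : F, x ^ (q ^ 2) = x := fun x => hF ▸ FiniteField.pow_card x
  have hqq : q < q ^ 2 := by nlinarith
  have hcardE := pow_three_le_card_Eset hq2 hq hF
  have hlt1 : ∀ a i j, i < j → lt (i, a) (j, a) := by
    intro a i j hij
    have h := hmul _ _ (i, a) ((hone (j - i, 0)).resolve_left (by simp; omega))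
    simpa [Nat.sub_add_cancel hij.le] using h
  have hlt2 : ∀ a i j, i < j → lt (a, i) (a, j) := by
    intro a i j hij
    have h := hmul _ _ (a, i) ((hone (0, j - i)).resolve_left (by simp; omega))
    simpa [Nat.sub_add_cancel hij.le] using h
  rcases htot (q + 1, 0) (0, q) with h | h | h
  · simp at h
  · left
    have key := initialIdealWith_vanIdeal_eq_span hirr htrans hwf hmul (Eset F q)
      {(0, q), (q ^ 2, 0)} ?_ (Finset.range (q ^ 2) ×ˢ Finset.range q) ?_ ?_
    · simpa [Set.image_pair] using key
    · rintro g (rfl | rfl)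
      · refine ⟨_, neg_mem (Hpoly_mem_vanIdeal q), ?_⟩
        have : -Hpoly F q = monoXY F 0 q + (monoXY F 0 1 - monoXY F (q + 1) 0) := by
          simp [Hpoly, monoXY]
          ring
        rw [this]
        exact isLMwith_monoXY_add hirr (sub_mem (monoXY_mem_restrictSupport (hlt2 _ _ _ hq2))
          (monoXY_mem_restrictSupport h))
      · refine ⟨monoXY F (q ^ 2) 0 + -monoXY F 1 0, fun p _ => ?_,
          isLMwith_monoXY_add hirr (neg_mem (monoXY_mem_restrictSupport (hlt1 _ _ _ (by omega))))⟩
        simp [evalPt, monoXY, hxF]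
    · rintro ⟨a, b⟩ hm
      simp only [Finset.mem_product, Finset.mem_range, not_and_or, not_lt] at hm
      rcases hm with hm | hm
      · exact ⟨_, Or.inr rfl, hm, Nat.zero_le _⟩
      · exact ⟨_, Or.inl rfl, Nat.zero_le _, hm⟩
    · simp only [Finset.card_product, Finset.card_range]
      exact (by ring : q ^ 2 * q = q ^ 3).trans_le hcardE
  · right
    have key := initialIdealWith_vanIdeal_eq_span hirr htrans hwf hmul (Eset F q)
      {(q + 1, 0), (1, q ^ 2 - q), (0, q ^ 2)} ?_
      (Finset.range (q + 1) ×ˢ Finset.range (q ^ 2 - q) ∪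
        {0} ×ˢ Finset.Ico (q ^ 2 - q) (q ^ 2)) ?_ ?_
    · simpa [Set.image_insert_eq, Set.image_pair] using key
    · rintro g (rfl | rfl | rfl)
      · refine ⟨_, Hpoly_mem_vanIdeal q, ?_⟩
        have : Hpoly F q = monoXY F (q + 1) 0 + (-monoXY F 0 q - monoXY F 0 1) := by
          simp [Hpoly, monoXY]
          ring
        rw [this]
        exact isLMwith_monoXY_add hirr (sub_mem (neg_mem (monoXY_mem_restrictSupport h))
          (monoXY_mem_restrictSupport (htrans _ _ _ (hlt2 _ _ _ hq2) h)))
      · obtain ⟨hmonic, hdeg⟩ := monic_pow_add_X_pow_sub_one (F := F) hq2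
        refine ⟨_, X_mul_pow_add_X_pow_sub_one_mem_vanIdeal hq2 hF, ?_⟩
        rw [X_pow_mul_aeval_eq_monoXY_add hmonic, hdeg]
        exact isLMwith_monoXY_add hirr (Submodule.sum_mem _ fun i hi => Submodule.smul_mem _ _
          (monoXY_mem_restrictSupport (hlt2 _ _ _ (Finset.mem_range.1 hi))))
      · refine ⟨monoXY F 0 (q ^ 2) + -monoXY F 0 1, fun p _ => ?_,
          isLMwith_monoXY_add hirr (neg_mem (monoXY_mem_restrictSupport (hlt2 _ _ _ (by omega))))⟩
        simp [evalPt, monoXY, hxF]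
    · rintro ⟨a, b⟩ hm
      simp only [Finset.mem_union, Finset.mem_product, Finset.mem_range, Finset.mem_singleton,
        Finset.mem_Ico] at hm
      rcases Nat.lt_or_ge q a with ha | ha
      · exact ⟨_, Or.inl rfl, ha, Nat.zero_le _⟩
      rcases Nat.eq_zero_or_pos a with rfl | ha0
      · exact ⟨_, Or.inr (Or.inr rfl), le_rfl, by simp only; omega⟩
      · exact ⟨_, Or.inr (Or.inl rfl), ha0, by simp only; omega⟩
    · refine (Finset.card_union_le _ _).trans (le_trans ?_ hcardE)
      simp only [Finset.card_product, Finset.card_range, Finset.card_singleton, Nat.card_Ico,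
        Nat.sub_sub_self hqq.le, one_mul]
      zify [hqq.le]
      exact le_of_eq (by ring)
end

section
/- The residue classes of the monomials of B form an F-vector-space basis of the quotient ring A_E = F[x,y]/I_E; in particular dim_F A_E = q^3. -/
open MvPolynomial

/-- A polynomial of degree less than the size of a set of roots of it vanishes. -/
theorem coeff_eq_zero_of_sum_range_eq_zero {K : Type*} [Field K] (c : ℕ → K) (n : ℕ)
    (s : Finset K) (hs : n ≤ s.card) (h : ∀ a ∈ s, ∑ i ∈ Finset.range n, c i * a ^ i = 0) :
    ∀ i < n, c i = 0 := by
  have hp : (∑ i ∈ Finset.range n, Polynomial.monomial i (c i)) = 0 := by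
    apply Polynomial.eq_zero_of_degree_lt_of_eval_finset_eq_zero s
    · refine lt_of_lt_of_le ?_ (Nat.cast_le.mpr hs)
      refine (Polynomial.degree_lt_iff_coeff_zero _ _).mpr fun m hm => ?_
      rw [Polynomial.finsetSum_coeff]
      refine Finset.sum_eq_zero fun i hi => ?_
      have := Finset.mem_range.mp hi
      exact Polynomial.coeff_monomial_of_ne _ (by omega)
    · intro a ha
      simpa [Polynomial.eval_finsetSum] using h a ha
  intro i hi
  have := congrArg (fun p => Polynomial.coeff p i) hp
  simpa [Polynomial.finsetSum_coeff, Polynomial.coeff_monomial, hi] using this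

/-- The map `b ↦ b ^ q + b` takes values in the fixed field of `a ↦ a ^ q`. -/
theorem trace_pow_eq_self {q : ℕ} (hq : IsPrimePow q) {F : Type*} [Field F] [Fintype F]
    (hF : Fintype.card F = q ^ 2) (b : F) : (b ^ q + b) ^ q = b ^ q + b := by
  obtain ⟨p, k, hp, hk, rfl⟩ := hq
  have hp' : Nat.Prime p := hp.nat_prime
  have : Fact p.Prime := ⟨hp'⟩
  have : CharP F p := by
    obtain ⟨r, hr⟩ := CharP.exists F
    obtain ⟨n, hr', hn⟩ := FiniteField.card F r
    have hdvd : r ∣ (p ^ k) ^ 2 := by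
      rw [← hF, hn]
      exact dvd_pow_self r n.ne_zero
    have : r = p := (Nat.prime_dvd_prime_iff_eq hr' hp').mp
      (hr'.dvd_of_dvd_pow (hr'.dvd_of_dvd_pow hdvd))
    exact this ▸ hr
  rw [add_pow_char_pow, ← pow_mul, ← sq, ← hF, FiniteField.pow_card, add_comm]

open Polynomial in
/-- Every nonzero `c` with `c ^ q = c` is the `(q + 1)`-st power of `q + 1` elements of `F`. -/
theorem exists_finset_norm_fiber {q : ℕ} (hq2 : 2 ≤ q) {F : Type*} [Field F] [Fintype F]
    (hF : Fintype.card F = q ^ 2) {c : F} (hc0 : c ≠ 0) (hc : c ^ q = c) :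
    ∃ s : Finset F, s.card = q + 1 ∧ ∀ a ∈ s, a ^ (q + 1) = c := by
  classical
  have hc1 : c ^ (q - 1) = 1 := by
    apply mul_right_cancel₀ hc0
    rw [← pow_succ, Nat.sub_add_cancel (by omega), hc, one_mul]
  have hcard : q ^ 2 = (q + 1) * (q - 1) + 1 := by
    obtain ⟨k, rfl⟩ := Nat.exists_eq_add_of_le hq2
    have : 2 + k - 1 = k + 1 := by omega
    rw [this]; ring
  have hdvd : (Polynomial.X ^ (q + 1) - Polynomial.C c : F[X]) ∣
      Polynomial.X ^ Fintype.card F - Polynomial.X := by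
    have h1 := sub_dvd_pow_sub_pow (Polynomial.X ^ (q + 1) : F[X]) (Polynomial.C c) (q - 1)
    rw [← Polynomial.C_pow, hc1, ← pow_mul, Polynomial.C_1] at h1
    have h2 : (Polynomial.X ^ Fintype.card F - Polynomial.X : F[X]) =
        (Polynomial.X ^ ((q + 1) * (q - 1)) - 1) * Polynomial.X := by
      rw [hF, hcard, pow_succ]; ring
    rw [h2]
    exact h1.mul_right X
  have hne : (Polynomial.X ^ Fintype.card F - Polynomial.X : F[X]) ≠ 0 :=
    FiniteField.X_pow_card_sub_X_ne_zero F Fintype.one_lt_card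
  have hroots := FiniteField.roots_X_pow_card_sub_X F
  have hsplits : (Polynomial.X ^ Fintype.card F - Polynomial.X : F[X]).Splits := by
    rw [splits_iff_card_roots, hroots, FiniteField.X_pow_card_sub_X_natDegree_eq F
      Fintype.one_lt_card]
    rfl
  have hnodup : (Polynomial.X ^ (q + 1) - Polynomial.C c : F[X]).roots.Nodup := by
    refine Multiset.nodup_of_le (roots.le_of_dvd hne hdvd) ?_
    rw [hroots]
    exact Finset.univ.nodup
  refine ⟨(Polynomial.X ^ (q + 1) - Polynomial.C c : F[X]).roots.toFinset, ?_, fun a ha => ?_⟩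
  · rw [Multiset.toFinset_card_of_nodup hnodup,
      splits_iff_card_roots.mp (hsplits.of_dvd hne hdvd), natDegree_X_pow_sub_C]
  · have := (mem_roots'.mp (Multiset.mem_toFinset.mp ha)).2
    simpa [sub_eq_zero] using this

open Polynomial in
/-- The equation `b ^ q + b = c` has at most `q` solutions. -/
theorem card_trace_fiber_le {q : ℕ} (hq2 : 2 ≤ q) {F : Type*} [Field F] [Fintype F]
    [DecidableEq F] (c : F) :
    (Finset.univ.filter fun b : F => b ^ q + b = c).card ≤ q := by
  have hdeg : (Polynomial.X ^ q + (Polynomial.X - Polynomial.C c) : F[X]).natDegree = q := by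
    compute_degree!
    · simp [show q ≠ 0 by omega, show 1 ≠ q by omega]
    · omega
  have hne : (Polynomial.X ^ q + (Polynomial.X - Polynomial.C c) : F[X]) ≠ 0 := by
    intro h
    rw [h, natDegree_zero] at hdeg
    omega
  calc _ ≤ (Polynomial.X ^ q + (Polynomial.X - Polynomial.C c) : F[X]).roots.toFinset.card := by
        refine Finset.card_le_card fun b hb => ?_
        rw [Multiset.mem_toFinset, mem_roots hne]
        have := (Finset.mem_filter.mp hb).2
        simp [← this]
    _ ≤ _ := (Multiset.toFinset_card_le _).trans ((card_roots' _).trans hdeg.le)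

/-- The Hermitian curve has at most `q ^ 3` rational affine points. -/
theorem card_Eset_le {q : ℕ} (hq2 : 2 ≤ q) {F : Type} [Field F] [Fintype F]
    (hF : Fintype.card F = q ^ 2) : Nat.card (Eset F q) ≤ q ^ 3 := by
  classical
  have hE : Eset F q = ((Finset.univ : Finset F).biUnion fun a =>
      (Finset.univ.filter fun b : F => b ^ q + b = a ^ (q + 1)).image (Prod.mk a) :
      Finset (F × F)) := by
    ext ⟨a, b⟩
    simp [Eset, eq_comm]
  rw [hE, Nat.card_coe_set_eq, Set.ncard_coe_finset]
  calc _ ≤ Fintype.card F * q := Finset.card_biUnion_le_card_mul _ _ _ fun a _ =>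
        Finset.card_image_le.trans (card_trace_fiber_le hq2 _)
    _ = q ^ 3 := by rw [hF]; ring

/-- The number of exponents `s` with `x^r y^s` in `B`, for `r ≤ q`. -/
def Bheight (q r : ℕ) : ℕ := if r = 0 then q ^ 2 else q ^ 2 - q

/-- The exponent set `B` as a finite set. -/
def Bfinset (q : ℕ) : Finset (ℕ × ℕ) :=
  (Finset.range (q + 1) ×ˢ Finset.range (q ^ 2)).filter fun p => p.2 < Bheight q p.1

theorem mem_Bfinset {q : ℕ} (p : ℕ × ℕ) :
    p ∈ Bfinset q ↔ p.1 ∈ Finset.range (q + 1) ∧ p.2 ∈ Finset.range (Bheight q p.1) := by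
  have h : Bheight q p.1 ≤ q ^ 2 := by unfold Bheight; split_ifs <;> omega
  rw [Bfinset, Finset.mem_filter, Finset.mem_product]
  simp only [Finset.mem_range]
  omega

theorem coe_Bfinset {q : ℕ} (hq2 : 2 ≤ q) : (Bfinset q : Set (ℕ × ℕ)) = Bset q := by
  have : 2 * q ≤ q ^ 2 := by nlinarith
  ext p
  simp only [Finset.mem_coe, mem_Bfinset, Finset.mem_range, Bheight, Bset, Set.mem_ofPred_eq]
  split_ifs <;> omega

theorem card_Bfinset (q : ℕ) : (Bfinset q).card = q ^ 3 := by
  rw [Finset.card_eq_sum_ones,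
    Finset.sum_finset_product _ _ (fun r => Finset.range (Bheight q r)) mem_Bfinset,
    Finset.sum_range_succ']
  simp only [Bheight, Nat.add_eq_zero_iff, one_ne_zero, and_false, if_false, if_true,
    Finset.sum_const, Finset.card_range, smul_eq_mul, mul_one]
  have : q ≤ q ^ 2 := Nat.le_self_pow two_ne_zero q
  zify [this]
  ring

/-- A combination of monomials of `B` vanishing on the Hermitian curve is trivial. -/
theorem coeff_eq_zero_of_vanishes_on_Eset {q : ℕ} (hq2 : 2 ≤ q) (hq : IsPrimePow q)
    {F : Type} [Field F] [Fintype F] (hF : Fintype.card F = q ^ 2) (g : ℕ × ℕ → F)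
    (hg : ∀ a b : F, (a, b) ∈ Eset F q →
      ∑ p ∈ Bfinset q, g p * (a ^ p.1 * b ^ p.2) = 0) :
    ∀ p ∈ Bfinset q, g p = 0 := by
  classical
  have hsum : ∀ a b : F, (a, b) ∈ Eset F q → ∑ r ∈ Finset.range (q + 1),
      (∑ s ∈ Finset.range (Bheight q r), g (r, s) * b ^ s) * a ^ r = 0 := by
    intro a b hab
    rw [← hg a b hab,
      Finset.sum_finset_product _ _ (fun r => Finset.range (Bheight q r)) mem_Bfinset]
    refine Finset.sum_congr rfl fun r _ => ?_
    rw [Finset.sum_mul]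
    exact Finset.sum_congr rfl fun s _ => by ring
  have hne : ∀ b : F, b ^ q + b ≠ 0 → ∀ r < q + 1,
      ∑ s ∈ Finset.range (Bheight q r), g (r, s) * b ^ s = 0 := by
    intro b hb
    obtain ⟨S, hS, hSb⟩ := exists_finset_norm_fiber hq2 hF hb (trace_pow_eq_self hq hF b)
    exact coeff_eq_zero_of_sum_range_eq_zero _ _ S hS.ge fun a ha => hsum a b (hSb a ha)
  have hzero : ∀ b : F, ∑ s ∈ Finset.range (Bheight q 0), g (0, s) * b ^ s = 0 := by
    intro b
    by_cases hb : b ^ q + b = 0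
    · have h := hsum 0 b (by simp [Eset, hb])
      rw [Finset.sum_range_succ'] at h
      simpa using h
    · exact hne b hb 0 (by omega)
  rintro ⟨r, s⟩ hp
  obtain ⟨hr, hs⟩ := (mem_Bfinset _).mp hp
  rw [Finset.mem_range] at hr hs
  by_cases hr0 : r = 0
  · subst hr0
    exact coeff_eq_zero_of_sum_range_eq_zero (fun s => g (0, s)) _ Finset.univ
      (by simp [Bheight, hF]) (fun b _ => hzero b) s hs
  · refine coeff_eq_zero_of_sum_range_eq_zero (fun s => g (r, s)) _
      (Finset.univ.filter fun b : F => ¬ b ^ q + b = 0) ?_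
      (fun b hb => hne b (Finset.mem_filter.mp hb).2 r hr) s hs
    have h1 := Finset.card_filter_add_card_filter_not (s := (Finset.univ : Finset F))
      (fun b : F => b ^ q + b = 0)
    have h2 := card_trace_fiber_le hq2 (0 : F)
    rw [Finset.card_univ, hF] at h1
    simp only [Bheight, if_neg hr0]
    omega

/-- Evaluation at the points of `S`, as an algebra map. -/
noncomputable def evalOn {F : Type} [Field F] (S : Set (F × F)) :
    MvPolynomial (Fin 2) F →ₐ[F] (S → F) :=
  AlgHom.pi fun p => MvPolynomial.aeval ![p.1.1, p.1.2]

theorem evalOn_apply {F : Type} [Field F] (S : Set (F × F)) (f : MvPolynomial (Fin 2) F)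
    (p : S) : evalOn S f p = evalPt p.1 f := by
  simp [evalOn, evalPt, MvPolynomial.aeval_eq_eval]

theorem vanIdeal_eq_ker_evalOn {F : Type} [Field F] (S : Set (F × F)) :
    vanIdeal F S = RingHom.ker (evalOn S) := by
  ext f
  rw [RingHom.mem_ker, funext_iff]
  simp only [evalOn_apply, Pi.zero_apply, Subtype.forall]
  rfl

/-- Evaluation embeds `F[x,y]/I_S` into the functions on `S`. -/
theorem exists_injective_quotient_vanIdeal {F : Type} [Field F] (S : Set (F × F)) :
    ∃ φ : (MvPolynomial (Fin 2) F ⧸ vanIdeal F S) →ₗ[F] (S → F), Function.Injective φ := by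
  rw [vanIdeal_eq_ker_evalOn]
  exact ⟨(Ideal.kerLiftAlg (evalOn S)).toLinearMap, Ideal.kerLiftAlg_injective (evalOn S)⟩

theorem stmt_4 (q : ℕ) (hq2 : 2 ≤ q) (hq : IsPrimePow q)
    (F : Type) [Field F] [Fintype F] (hF : Fintype.card F = q ^ 2) :
    LinearIndependent F (fun p : ↥(Bset q) =>
      Ideal.Quotient.mk (vanIdeal F (Eset F q)) (monoXY F p.1.1 p.1.2)) ∧
    Submodule.span F (Set.range (fun p : ↥(Bset q) =>
      Ideal.Quotient.mk (vanIdeal F (Eset F q)) (monoXY F p.1.1 p.1.2))) = ⊤ ∧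
    Module.finrank F (MvPolynomial (Fin 2) F ⧸ vanIdeal F (Eset F q)) = q ^ 3 := by
  classical
  have hli : LinearIndependent F (fun p : ↥(Bset q) =>
      Ideal.Quotient.mk (vanIdeal F (Eset F q)) (monoXY F p.1.1 p.1.2)) := by
    change LinearIndepOn F (fun p : ℕ × ℕ =>
      Ideal.Quotient.mk (vanIdeal F (Eset F q)) (monoXY F p.1 p.2)) (Bset q)
    rw [← coe_Bfinset hq2, linearIndepOn_finset_iff]
    intro g hg
    have hmem : ∑ p ∈ Bfinset q, g p • monoXY F p.1 p.2 ∈ vanIdeal F (Eset F q) := by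
      rw [← Ideal.Quotient.eq_zero_iff_mem, map_sum]
      exact hg
    refine coeff_eq_zero_of_vanishes_on_Eset hq2 hq hF g fun a b hab => ?_
    have h : evalPt (a, b) _ = 0 := hmem (a, b) hab
    simpa [evalPt, monoXY, MvPolynomial.smul_eval] using h
  obtain ⟨φ, hφ⟩ := exists_injective_quotient_vanIdeal (Eset F q)
  have : Module.Finite F (MvPolynomial (Fin 2) F ⧸ vanIdeal F (Eset F q)) :=
    Module.Finite.of_injective φ hφ
  have : Fintype (Bset q) := Fintype.ofEquiv (Bfinset q) (Equiv.setCongr (coe_Bfinset hq2))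
  have hcard : Fintype.card (Bset q) = q ^ 3 := by
    rw [← Nat.card_eq_fintype_card, ← coe_Bfinset hq2, Nat.card_coe_set_eq,
      Set.ncard_coe_finset, card_Bfinset]
  have hrank : Module.finrank F (MvPolynomial (Fin 2) F ⧸ vanIdeal F (Eset F q)) = q ^ 3 := by
    apply le_antisymm
    · have h := LinearMap.finrank_le_finrank_of_injective hφ
      rw [Module.finrank_fintype_fun_eq_card, ← Nat.card_eq_fintype_card] at h
      exact h.trans (card_Eset_le hq2 hF)
    · exact hcard ▸ hli.fintype_card_le_finrank
  exact ⟨hli, hli.span_eq_top_of_card_eq_finrank' (hcard.trans hrank.symm), hrank⟩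
end

section
/- Let D ⊆ E be a finite set of F-rational points of the Hermitian curve and suppose that the monomial x^r y^s, with r ≤ q, belongs to In_≺(I_D). Then |D| ≤ rq + s(q+1). -/
open MvPolynomial

/-- The function `(x, y) ↦ x ^ a * y ^ b` on a set of points. -/
def monoFun {F : Type} [Field F] (D : Set (F × F)) (a b : ℕ) : D → F :=
  fun p => p.1.1 ^ a * p.1.2 ^ b

/-- The exponents `(a, b)`, `a ≤ q`, whose weight `a * q + b * (q + 1)` does not lie in the
translate of the semigroup `⟨q, q + 1⟩` by `r * q + s * (q + 1)`. -/
def footprint (q r s : ℕ) : Finset (ℕ × ℕ) :=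
  Finset.Ico r (q + 1) ×ˢ Finset.range s ∪ Finset.range r ×ˢ Finset.range (s + q)

theorem card_footprint_le {q r s : ℕ} (hr : r ≤ q) :
    (footprint q r s).card ≤ r * q + s * (q + 1) := by
  refine (Finset.card_union_le _ _).trans (le_of_eq ?_)
  obtain ⟨k, rfl⟩ := Nat.exists_eq_add_of_le hr
  have h : r + k + 1 - r = k + 1 := by omega
  simp only [Finset.card_product, Nat.card_Ico, Finset.card_range, h]
  ring

/-- A leading monomial `x ^ r * y ^ s` with `r ≤ q` also dominates for the weight
`x ↦ q, y ↦ q + 1`. -/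
theorem weight_lt_of_precOrd {q a b r s : ℕ} (hr : r ≤ q) (h : precOrd (a, b) (r, s)) :
    a * q + b * (q + 1) < r * q + s * (q + 1) := by
  rcases h with h | ⟨h, h'⟩
  · simp only at h
    have h1 : (a + b + 1) * (q + 1) ≤ (r + s) * (q + 1) := Nat.mul_le_mul_right _ h
    nlinarith
  · simp only at h h'
    have h1 : (a + b) * q = (r + s) * q := by rw [h]
    nlinarith

theorem exists_isLMwith_of_mono_mem {F : Type} [Field F] {lt : ℕ × ℕ → ℕ × ℕ → Prop}
    {I : Ideal (MvPolynomial (Fin 2) F)} {r s : ℕ}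
    (h : monoXY F r s ∈ initialIdealWith lt I) :
    ∃ f ∈ I, ∃ r' ≤ r, ∃ s' ≤ s, IsLMwith lt f r' s' := by
  have hmono : ∀ a b : ℕ, monoXY F a b =
      monomial (Finsupp.single 0 a + Finsupp.single 1 b) 1 := by
    intro a b
    rw [monoXY, X_pow_eq_monomial, X_pow_eq_monomial, monomial_mul, one_mul]
  have hset : {g | ∃ f ∈ I, f ≠ 0 ∧ ∃ r s, IsLMwith lt f r s ∧ g = monoXY F r s} =
      (fun d => monomial d (1 : F)) ''
        {d | ∃ f ∈ I, IsLMwith lt f (d 0) (d 1)} := by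
    ext g
    constructor
    · rintro ⟨f, hf, -, a, b, hlm, rfl⟩
      exact ⟨_, ⟨f, hf, by simpa using hlm⟩, (hmono a b).symm⟩
    · rintro ⟨d, ⟨f, hf, hlm⟩, rfl⟩
      refine ⟨f, hf, ?_, d 0, d 1, hlm, ?_⟩
      · rintro rfl
        exact hlm.1 (coeff_zero _)
      · rw [hmono]
        congr 2
        ext i
        fin_cases i <;> simp
  rw [initialIdealWith, hset, mem_ideal_span_monomial_image] at h
  obtain ⟨d, ⟨f, hf, hlm⟩, hle⟩ := h (Finsupp.single 0 r + Finsupp.single 1 s) (by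
    rw [hmono, mem_support_iff, coeff_monomial, if_pos rfl]
    exact one_ne_zero)
  exact ⟨f, hf, d 0, by simpa using hle 0, d 1, by simpa using hle 1, hlm⟩

theorem monoFun_eq_add_of_subset_Eset {F : Type} [Field F] {q : ℕ} {D : Set (F × F)}
    (hD : D ⊆ Eset F q) (a b : ℕ) :
    monoFun D (a + (q + 1)) b = monoFun D a (b + q) + monoFun D a (b + 1) := by
  ext ⟨p, hp⟩
  have h : p.1 ^ (q + 1) = p.2 ^ q + p.2 := hD hp
  simp only [monoFun, Pi.add_apply, pow_add p.1 a, h]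
  ring

theorem sum_smul_monoFun_eq_zero {F : Type} [Field F] {D : Set (F × F)}
    {f : MvPolynomial (Fin 2) F} (hf : f ∈ vanIdeal F D) (i j : ℕ) :
    ∑ d ∈ f.support, coeff d f • monoFun D (i + d 0) (j + d 1) = 0 := by
  ext ⟨p, hp⟩
  have h : evalPt p f = 0 := hf p hp
  rw [evalPt, eval_eq'] at h
  have h' := congrArg (fun t => p.1 ^ i * p.2 ^ j * t) h
  simp only [mul_zero, Finset.mul_sum, Fin.prod_univ_two] at h'
  simp only [Finset.sum_apply, Pi.smul_apply, monoFun, smul_eq_mul, Pi.zero_apply]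
  rw [← h']
  refine Finset.sum_congr rfl fun d _ => ?_
  simp only [Matrix.cons_val_zero, Matrix.cons_val_one]
  ring

/-- On the zeros of `f`, a multiple of the leading monomial of `f` is a combination of monomials
of smaller weight. -/
theorem monoFun_mem_of_isLMwith {F : Type} [Field F] {q r s : ℕ} (hr : r ≤ q) {D : Set (F × F)}
    {f : MvPolynomial (Fin 2) F} (hf : f ∈ vanIdeal F D) (hlm : IsLMwith precOrd f r s)
    (V : Submodule F (D → F)) (i j : ℕ)
    (hV : ∀ a b, a * q + b * (q + 1) < (i + r) * q + (j + s) * (q + 1) → monoFun D a b ∈ V) :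
    monoFun D (i + r) (j + s) ∈ V := by
  have hsum := sum_smul_monoFun_eq_zero hf i j
  have hmem : Finsupp.single 0 r + Finsupp.single 1 s ∈ f.support := mem_support_iff.2 hlm.1
  rw [← Finset.add_sum_erase _ _ hmem, add_eq_zero_iff_eq_neg] at hsum
  rw [← V.smul_mem_iff hlm.1]
  have hexp : ∀ k l : ℕ, (Finsupp.single 0 k + Finsupp.single 1 l : Fin 2 →₀ ℕ) 0 = k ∧
      (Finsupp.single 0 k + Finsupp.single 1 l : Fin 2 →₀ ℕ) 1 = l := by simp
  rw [(hexp r s).1, (hexp r s).2] at hsum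
  rw [hsum]
  refine V.neg_mem (V.sum_mem fun d hd => V.smul_mem _ (hV _ _ ?_))
  obtain ⟨hne, hd⟩ := Finset.mem_erase.1 hd
  rcases hlm.2 d hd with h | h
  · refine absurd ?_ hne
    simp only [expPair, Prod.mk.injEq] at h
    ext k
    fin_cases k <;> simp [h.1, h.2]
  · have := weight_lt_of_precOrd hr h
    nlinarith

theorem monoFun_mem_span_footprint {F : Type} [Field F] {q r s : ℕ} (hq : 2 ≤ q) (hr : r ≤ q)
    {D : Set (F × F)} (hD : D ⊆ Eset F q)
    {f : MvPolynomial (Fin 2) F} (hf : f ∈ vanIdeal F D) (hlm : IsLMwith precOrd f r s)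
    (n : ℕ) : ∀ a b, a * q + b * (q + 1) = n → monoFun D a b ∈
      Submodule.span F (Set.range fun e : footprint q r s => monoFun D e.1.1 e.1.2) := by
  set V := Submodule.span F (Set.range fun e : footprint q r s => monoFun D e.1.1 e.1.2)
  induction n using Nat.strong_induction_on with
  | _ n ih =>
  have hred : ∀ a b, a * q + b * (q + 1) = n → r ≤ a → s ≤ b → monoFun D a b ∈ V := by
    intro a b hab ha hb
    have := monoFun_mem_of_isLMwith hr hf hlm V (a - r) (b - s)
    rw [Nat.sub_add_cancel ha, Nat.sub_add_cancel hb] at this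
    exact this fun a' b' h => ih _ (hab ▸ h) a' b' rfl
  intro a
  induction a using Nat.strong_induction_on with
  | _ a iha =>
  intro b hab
  by_cases haq : q < a
  · obtain ⟨c, rfl⟩ := Nat.exists_eq_add_of_le' (show q + 1 ≤ a from haq)
    rw [monoFun_eq_add_of_subset_Eset hD]
    refine V.add_mem (iha c (by omega) _ ?_) (ih _ ?_ _ _ rfl)
    · rw [← hab]; ring
    · rw [← hab]; nlinarith
  by_cases har : r ≤ a
  · by_cases hbs : s ≤ b
    · exact hred a b hab har hbs
    · exact Submodule.subset_span ⟨⟨(a, b), by simp [footprint]; omega⟩, rfl⟩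
  by_cases hbs : s + q ≤ b
  · obtain ⟨c, rfl⟩ := Nat.exists_eq_add_of_le' (le_of_add_le_right hbs)
    rw [eq_sub_of_add_eq (monoFun_eq_add_of_subset_Eset hD a c).symm]
    refine V.sub_mem (hred _ _ ?_ (by omega) (by omega)) (ih _ ?_ _ _ rfl)
    · rw [← hab]; ring
    · rw [← hab]; nlinarith
  · exact Submodule.subset_span ⟨⟨(a, b), by simp [footprint]; omega⟩, rfl⟩

/-- Over a finite field every function on a set of points is a polynomial function. -/
theorem eq_top_of_monoFun_mem {F : Type} [Field F] [Fintype F] {D : Set (F × F)}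
    {V : Submodule F (D → F)} (hV : ∀ a b, monoFun D a b ∈ V) : V = ⊤ := by
  classical
  refine eq_top_iff.2 fun g _ => ?_
  obtain ⟨f, -, hf⟩ : (fun v : Fin 2 → F => if h : (v 0, v 1) ∈ D then g ⟨_, h⟩ else 0) ∈
      (restrictDegree (Fin 2) F (Fintype.card F - 1)).map (evalₗ F (Fin 2)) := by
    rw [map_restrict_dom_evalₗ]
    trivial
  have hg : g = ∑ d ∈ f.support, coeff d f • monoFun D (d 0) (d 1) := by
    ext ⟨p, hp⟩
    have h := congrFun hf ![p.1, p.2]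
    rw [evalₗ_apply, eval_eq'] at h
    simpa [hp, Fin.prod_univ_two, monoFun] using h.symm
  rw [hg]
  exact V.sum_mem fun d _ => V.smul_mem _ (hV _ _)

theorem stmt_11 (q : ℕ) (hq2 : 2 ≤ q) (hq : IsPrimePow q)
    (F : Type) [Field F] [Fintype F] (hF : Fintype.card F = q ^ 2)
    (D : Set (F × F)) (hD : D ⊆ Eset F q)
    (r s : ℕ) (hr : r ≤ q)
    (hmem : monoXY F r s ∈ initialIdealWith precOrd (vanIdeal F D)) :
    D.ncard ≤ r * q + s * (q + 1) := by
  obtain ⟨f, hf, r', hr', s', hs', hlm⟩ := exists_isLMwith_of_mono_mem hmem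
  have hrq : r' ≤ q := hr'.trans hr
  have htop := eq_top_of_monoFun_mem fun a b =>
    monoFun_mem_span_footprint hq2 hrq hD hf hlm _ a b rfl
  have hcard := finrank_range_le_card (R := F)
    (fun e : footprint q r' s' => monoFun D e.1.1 e.1.2)
  have : Fintype D := Fintype.ofFinite D
  rw [Set.finrank, htop, finrank_top, Module.finrank_fintype_fun_eq_card, Fintype.card_coe,
    ← Nat.card_eq_fintype_card, Nat.card_coe_set_eq] at hcard
  calc D.ncard ≤ r' * q + s' * (q + 1) := hcard.trans (card_footprint_le hrq)
    _ ≤ r * q + s * (q + 1) := by gcongr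
end
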